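/- Let (X,d) be a metric space and let X' denote the set of accumulation points of X. The following conditions are equivalent: (1) every ward continuous function f : X → ℝ is uniformly continuous; (2) every pseudo-Cauchy sequence with distinct terms in X has a subsequence that is Bourbaki quasi-Cauchy in X; (3) every sequence (x_n) in X with lim_{n→∞} I(x_n) = 0 has a subsequence that is Bourbaki quasi-Cauchy in X; (4) X' is Bourbaki quasi-precompact in X, and every infinite subset U of X that is Bourbaki quasi-complete in X and disjoint from X' is uniformly discrete; (5) X' is Bourbaki quasi-precompact in X, and every infinite subset U of X that is Bourbaki quasi-complete in X and disjoint from X' satisfies inf{I(x) : x ∈ U} > 0; (6) X' is Bourbaki quasi-precompact in X, and every sequence (x_n) of isolated points of X having no subsequence that is Bourbaki quasi-Cauchy in X satisfies inf{I(x_n) : n ∈ ℕ} > 0; (7) every discrete subset A of X that is Bourbaki quasi-complete in X is uniformly discrete; (8) every subset A of X that is Bourbaki quasi-complete in X is a UC space. -/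

import Mathlib

open Filter Metric Set

/-- A sequence is quasi-Cauchy if distances of consecutive terms tend to zero. -/
def QuasiCauchy {α : Type*} [MetricSpace α] (u : ℕ → α) : Prop :=
  ∀ ε > (0:ℝ), ∃ n₀ : ℕ, ∀ n ≥ n₀, dist (u (n+1)) (u n) < ε

/-- A function is ward continuous if it preserves quasi-Cauchy sequences. -/
def WardContinuous {α β : Type*} [MetricSpace α] [MetricSpace β] (f : α → β) : Prop :=
  ∀ u : ℕ → α, QuasiCauchy u → QuasiCauchy (f ∘ u)

/-- A sequence is pseudo-Cauchy: arbitrarily far out there are two distinct indices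
whose terms are arbitrarily close. -/
def PseudoCauchy {α : Type*} [MetricSpace α] (u : ℕ → α) : Prop :=
  ∀ ε > (0:ℝ), ∀ n : ℕ, ∃ j k : ℕ, j ≠ k ∧ n < j ∧ n < k ∧ dist (u j) (u k) < ε

/-- `y` lies in the ε-chainable component of `x`: they are joined by an ε-chain. -/
def ChainConn {α : Type*} [MetricSpace α] (ε : ℝ) (x y : α) : Prop :=
  ∃ (n : ℕ) (p : ℕ → α), p 0 = x ∧ p n = y ∧ ∀ i < n, dist (p i) (p (i+1)) < ε

/-- A sequence is Bourbaki quasi-Cauchy if for each ε > 0 it is eventually in one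
ε-chainable component. -/
def BourbakiQuasiCauchy {α : Type*} [MetricSpace α] (u : ℕ → α) : Prop :=
  ∀ ε > (0:ℝ), ∃ (p : α) (n₀ : ℕ), ∀ n ≥ n₀, ChainConn ε p (u n)

/-- A set `A` is Bourbaki quasi-precompact in the ambient space: for every ε > 0,
`A` is covered by finitely many ε-chainable components. -/
def BourbakiQuasiPrecompactIn {α : Type*} [MetricSpace α] (A : Set α) : Prop :=
  ∀ ε > (0:ℝ), ∃ s : Finset α, ∀ a ∈ A, ∃ p ∈ s, ChainConn ε p a

/-- `A` is Bourbaki quasi-complete in the ambient space: every sequence in `A` which is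
Bourbaki quasi-Cauchy in the whole space has a cluster point in `A`. -/
def BourbakiQuasiCompleteIn {α : Type*} [MetricSpace α] (A : Set α) : Prop :=
  ∀ u : ℕ → α, (∀ n, u n ∈ A) → BourbakiQuasiCauchy u → ∃ c ∈ A, MapClusterPt c atTop u

/-- The degree of isolation `I(x) = d(x, X \ {x})` of a point. -/
noncomputable def degIsol {α : Type*} [MetricSpace α] (x : α) : ℝ :=
  Metric.infDist x ({x}ᶜ : Set α)

/-- The set of accumulation points of the space. -/
def accSet (α : Type*) [MetricSpace α] : Set α :=
  {x | x ∈ closure ({x}ᶜ : Set α)}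

/-- A set is uniformly discrete if its distinct points stay a fixed distance apart. -/
def UniformlyDiscrete {α : Type*} [MetricSpace α] (A : Set α) : Prop :=
  ∃ δ > (0:ℝ), ∀ x ∈ A, ∀ y ∈ A, x ≠ y → δ ≤ dist x y

/-- A set is discrete (as a subspace) if each of its points is isolated in it. -/
def DiscreteIn {α : Type*} [MetricSpace α] (A : Set α) : Prop :=
  ∀ x ∈ A, ∃ ε > (0:ℝ), ∀ y ∈ A, dist x y < ε → y = x

namespace ChainConn

variable {X : Type*} [MetricSpace X] {ε δ : ℝ} {x y z : X}

theorem refl (ε : ℝ) (x : X) : ChainConn ε x x :=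
  ⟨0, fun _ => x, rfl, rfl, fun _ hi => absurd hi (Nat.not_lt_zero _)⟩

theorem of_dist_lt (h : dist x y < ε) : ChainConn ε x y := by
  refine ⟨1, fun i => if i = 0 then x else y, by simp, by simp, fun i hi => ?_⟩
  obtain rfl : i = 0 := by omega
  simpa using h

theorem symm (h : ChainConn ε x y) : ChainConn ε y x := by
  obtain ⟨n, p, h0, hn, hp⟩ := h
  refine ⟨n, fun i => p (n - i), by simpa using hn, by simpa using h0, fun i hi => ?_⟩
  have := hp (n - (i + 1)) (by omega)
  rw [dist_comm, show n - (i + 1) + 1 = n - i by omega] at this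
  exact this

theorem trans (h : ChainConn ε x y) (h' : ChainConn ε y z) : ChainConn ε x z := by
  obtain ⟨n, p, h0, hn, hp⟩ := h
  obtain ⟨m, q, h0', hm, hq⟩ := h'
  refine ⟨n + m, fun i => if i < n then p i else q (i - n), ?_, ?_, fun i hi => ?_⟩
  · rcases Nat.eq_zero_or_pos n with rfl | hpos
    · simp [h0', ← hn, h0]
    · simp [hpos, h0]
  · simp [hm]
  · rcases lt_trichotomy (i + 1) n with h | h | h
    · simpa [h, show i < n by omega] using hp i (by omega)
    · have := hp i (by omega)
      rw [h, hn] at this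
      simpa [show i < n by omega, h, h0'] using this
    · have := hq (i - n) (by omega)
      rw [show i - n + 1 = i + 1 - n by omega] at this
      simpa [show ¬ i < n by omega, show ¬ i + 1 < n by omega] using this

theorem mono (h : ChainConn ε x y) (hle : ε ≤ δ) : ChainConn δ x y := by
  obtain ⟨n, p, h0, hn, hp⟩ := h
  exact ⟨n, p, h0, hn, fun i hi => (hp i hi).trans_le hle⟩

end ChainConn

section Subsequences

variable {X : Type*} [MetricSpace X]

/-- Some subsequence is Bourbaki quasi-Cauchy. -/
def HasBourbakiSubseq (u : ℕ → X) : Prop :=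
  ∃ φ : ℕ → ℕ, StrictMono φ ∧ BourbakiQuasiCauchy (u ∘ φ)

theorem not_hasBourbakiSubseq_of_separated {ε : ℝ} (hε : 0 < ε) {u : ℕ → X}
    (hu : ∀ i j, ChainConn ε (u i) (u j) → i = j) : ¬ HasBourbakiSubseq u := by
  rintro ⟨φ, hφ, h⟩
  obtain ⟨p, N, hN⟩ := h ε hε
  have := hφ.injective (hu _ _ ((hN N le_rfl).symm.trans (hN (N + 1) (by omega))))
  omega

/-- A sequence without Bourbaki quasi-Cauchy subsequences has a subsequence whose terms
lie in pairwise distinct `ε`-chainable components, for some `ε > 0`. -/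
theorem exists_separated_of_not_hasBourbakiSubseq {u : ℕ → X} (hu : ¬ HasBourbakiSubseq u) :
    ∃ ε > (0 : ℝ), ∃ φ : ℕ → ℕ, StrictMono φ ∧
      ∀ i j, ChainConn ε (u (φ i)) (u (φ j)) → i = j := by
  have hF : (hyperfilter ℕ : Filter ℕ) ≤ atTop := Nat.hyperfilter_le_atTop
  by_cases h : ∀ ε > (0 : ℝ), ∃ p : X, ∀ᶠ n in (hyperfilter ℕ : Filter ℕ), ChainConn ε p (u n)
  · refine absurd ?_ hu
    choose p hp using fun k : ℕ => h (1 / ((k : ℝ) + 1)) Nat.one_div_pos_of_nat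
    have hfreq : ∀ n, ∃ᶠ k in atTop, ∀ i : ℕ, i ≤ n → ChainConn (1 / ((i : ℝ) + 1)) (p i) (u k) := by
      intro n
      refine Filter.Frequently.filter_mono (Eventually.frequently ?_) hF
      exact (Set.finite_Iic n).eventually_all.2 fun i _ => hp i
    obtain ⟨φ, hφ, hφp⟩ := extraction_forall_of_frequently hfreq
    refine ⟨φ, hφ, fun ε hε => ?_⟩
    obtain ⟨k, hk⟩ := exists_nat_one_div_lt hε
    exact ⟨p k, k, fun n hn => (hφp n k hn).mono hk.le⟩
  · push Not at h
    obtain ⟨ε, hε, h⟩ := h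
    obtain ⟨φ, -, hφ⟩ := exists_seq_of_forall_finset_exists (fun _ : ℕ => True)
      (fun a b => a < b ∧ ¬ ChainConn ε (u a) (u b)) (by
        intro s _
        have : ∀ᶠ n in (hyperfilter ℕ : Filter ℕ), ∀ a ∈ s, a < n ∧ ¬ ChainConn ε (u a) (u n) :=
          (Finset.eventually_all s).2 fun a _ =>
            ((eventually_gt_atTop a).filter_mono hF).and (h (u a))
        obtain ⟨n, hn⟩ := this.exists
        exact ⟨n, trivial, hn⟩)
    refine ⟨ε, hε, φ, fun i j hij => (hφ i j hij).1, fun i j hij => ?_⟩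
    rcases lt_trichotomy i j with hlt | heq | hlt
    · exact absurd hij (hφ i j hlt).2
    · exact heq
    · exact absurd hij.symm (hφ j i hlt).2

theorem BourbakiQuasiPrecompactIn.finite_of_separated {A : Set X}
    (hA : BourbakiQuasiPrecompactIn A) {ε : ℝ} (hε : 0 < ε) {u : ℕ → X}
    (hu : ∀ i j, ChainConn ε (u i) (u j) → i = j) : {n | u n ∈ A}.Finite := by
  obtain ⟨s, hs⟩ := hA ε hε
  choose! p hps hp using hs
  refine Set.Finite.of_finite_image (f := fun n => p (u n))
    (s.finite_toSet.subset ?_) fun i hi j hj hij => ?_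
  · rintro _ ⟨n, hn, rfl⟩
    exact hps _ hn
  · have h1 := hp (u i) hi
    have h2 := hp (u j) hj
    simp only at hij
    rw [hij] at h1
    exact hu _ _ (h1.symm.trans h2)

theorem exists_separated_of_not_precompact {A : Set X} (hA : ¬ BourbakiQuasiPrecompactIn A) :
    ∃ ε > (0 : ℝ), ∃ u : ℕ → X, (∀ n, u n ∈ A) ∧ ∀ i j, ChainConn ε (u i) (u j) → i = j := by
  unfold BourbakiQuasiPrecompactIn at hA
  push Not at hA
  obtain ⟨ε, hε, h⟩ := hA
  obtain ⟨u, huA, hu⟩ := exists_seq_of_forall_finset_exists (fun x : X => x ∈ A)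
    (fun a b => ¬ ChainConn ε a b) (fun s _ => h s)
  refine ⟨ε, hε, u, huA, fun i j hij => ?_⟩
  rcases lt_trichotomy i j with hlt | heq | hlt
  · exact absurd hij (hu i j hlt)
  · exact heq
  · exact absurd hij.symm (hu j i hlt)

end Subsequences

section DegreeOfIsolation

variable {X : Type*} [MetricSpace X]

theorem degIsol_nonneg (x : X) : 0 ≤ degIsol x := infDist_nonneg

theorem degIsol_le_dist {x y : X} (h : x ≠ y) : degIsol x ≤ dist x y :=
  infDist_le_dist_of_mem (by simpa using h.symm)

theorem degIsol_eq_zero {x : X} (h : x ∈ accSet X) : degIsol x = 0 :=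
  infDist_zero_of_mem_closure h

/-- Near an isolated point there is no other point. -/
theorem eventually_eq_of_notMem_accSet {c : X} (h : c ∉ accSet X) :
    ∀ᶠ x in nhds c, x = c := by
  have : c ∉ closure ({c}ᶜ : Set X) := h
  simpa only [mem_closure_iff_frequently, not_frequently, mem_compl_iff, mem_singleton_iff,
    not_not] using this

theorem degIsol_pos {x y : X} (hx : x ∉ accSet X) (hy : y ≠ x) : 0 < degIsol x := by
  have hne : ({x}ᶜ : Set X).Nonempty := ⟨y, by simpa using hy⟩
  refine lt_of_le_of_ne (degIsol_nonneg x) fun h => hx ?_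
  exact (mem_closure_iff_infDist_zero hne).2 h.symm

theorem tendsto_degIsol_of_dist {x y : ℕ → X} (hne : ∀ n, x n ≠ y n)
    (h : ∀ n : ℕ, dist (x n) (y n) < 1 / ((n : ℝ) + 1)) :
    Tendsto (fun n => degIsol (x n)) atTop (nhds 0) :=
  squeeze_zero (fun _ => degIsol_nonneg _)
    (fun n => (degIsol_le_dist (hne n)).trans (h n).le) tendsto_one_div_add_atTop_nhds_zero_nat

/-- Every sequence whose degrees of isolation tend to zero has a Bourbaki quasi-Cauchy
subsequence. -/
def IsolationCondition (X : Type*) [MetricSpace X] : Prop :=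
  ∀ u : ℕ → X, Tendsto (fun n => degIsol (u n)) atTop (nhds 0) → HasBourbakiSubseq u

end DegreeOfIsolation

section Consequences

variable {X : Type*} [MetricSpace X]

theorem IsolationCondition.precompact_accSet (h : IsolationCondition X) :
    BourbakiQuasiPrecompactIn (accSet X) := by
  by_contra hA
  obtain ⟨ε, hε, u, huA, hu⟩ := exists_separated_of_not_precompact hA
  refine not_hasBourbakiSubseq_of_separated hε hu (h u ?_)
  simp [degIsol_eq_zero (huA _)]

theorem IsolationCondition.exists_tendsto (h : IsolationCondition X) {A : Set X}
    (hA : BourbakiQuasiCompleteIn A) {u : ℕ → X} (huA : ∀ n, u n ∈ A)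
    (hu : Tendsto (fun n => degIsol (u n)) atTop (nhds 0)) :
    ∃ c ∈ A, ∃ φ : ℕ → ℕ, StrictMono φ ∧ Tendsto (u ∘ φ) atTop (nhds c) := by
  obtain ⟨φ, hφ, hB⟩ := h u hu
  obtain ⟨c, hc, hcl⟩ := hA (u ∘ φ) (fun n => huA _) hB
  obtain ⟨ψ, hψ, hlim⟩ := hcl.tendsto_subseq
  exact ⟨c, hc, φ ∘ ψ, hφ.comp hψ, hlim⟩

theorem IsolationCondition.hasBourbakiSubseq_of_pseudoCauchy (h : IsolationCondition X)
    {u : ℕ → X} (hu : PseudoCauchy u) (hinj : Function.Injective u) : HasBourbakiSubseq u := by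
  have hfreq : ∀ n : ℕ, ∃ᶠ k in atTop, degIsol (u k) < 1 / ((n : ℝ) + 1) := by
    intro n
    refine frequently_atTop.2 fun N => ?_
    obtain ⟨j, k, hjk, hj, -, hd⟩ := hu (1 / ((n : ℝ) + 1)) Nat.one_div_pos_of_nat N
    exact ⟨j, hj.le, (degIsol_le_dist (hinj.ne hjk)).trans_lt hd⟩
  obtain ⟨φ, hφ, hI⟩ := extraction_forall_of_frequently hfreq
  obtain ⟨ψ, hψ, hB⟩ := h (u ∘ φ) (squeeze_zero (fun n => degIsol_nonneg _)
    (fun n => (hI n).le) tendsto_one_div_add_atTop_nhds_zero_nat)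
  exact ⟨φ ∘ ψ, hφ.comp hψ, hB⟩

theorem IsolationCondition.uniformContinuous_of_complete (h : IsolationCondition X)
    {A : Set X} (hA : BourbakiQuasiCompleteIn A) {f : A → ℝ} (hf : Continuous f) :
    UniformContinuous f := by
  rw [Metric.uniformContinuous_iff]
  by_contra! hcon
  obtain ⟨ε, hε, hcon⟩ := hcon
  choose x y hxy hfxy using fun k : ℕ => hcon (1 / ((k : ℝ) + 1)) Nat.one_div_pos_of_nat
  have hne : ∀ n, (x n : X) ≠ y n := fun n heq => by
    have := hfxy n
    rw [Subtype.ext heq, dist_self] at this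
    linarith
  obtain ⟨c, hc, φ, hφ, hlim⟩ := h.exists_tendsto hA (u := fun n => (x n : X))
    (fun n => (x n).2) (tendsto_degIsol_of_dist hne hxy)
  have hx : Tendsto (x ∘ φ) atTop (nhds (⟨c, hc⟩ : A)) := tendsto_subtype_rng.2 hlim
  have hd : Tendsto (fun n => dist (x (φ n)) (y (φ n))) atTop (nhds 0) :=
    (squeeze_zero (fun n => dist_nonneg) (fun n => (hxy n).le)
      tendsto_one_div_add_atTop_nhds_zero_nat).comp hφ.tendsto_atTop
  have hy : Tendsto (y ∘ φ) atTop (nhds (⟨c, hc⟩ : A)) := (tendsto_iff_of_dist hd).1 hx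
  have hlim0 := ((hf.tendsto _).comp hx).dist ((hf.tendsto _).comp hy)
  rw [dist_self] at hlim0
  obtain ⟨n, hn⟩ := (hlim0.eventually (gt_mem_nhds hε)).exists
  exact absurd (hfxy (φ n)) (not_le.2 hn)

/-- A discrete space on which every continuous function is uniformly continuous is
uniformly discrete. -/
theorem DiscreteIn.uniformlyDiscrete {A : Set X} (hA : DiscreteIn A)
    (hUC : ∀ f : A → ℝ, Continuous f → UniformContinuous f) : UniformlyDiscrete A := by
  unfold UniformlyDiscrete
  by_contra! hcon
  choose x hx y hy hne hxy using fun k : ℕ => hcon (1 / ((k : ℝ) + 1)) Nat.one_div_pos_of_nat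
  obtain ⟨g, hg⟩ : ∃ g : X → ℕ, InjOn g (range x ∪ range y) :=
    countable_iff_exists_injOn.1 ((countable_range x).union (countable_range y))
  have hf : Continuous fun a : A => (g a : ℝ) := by
    refine continuous_iff_continuousAt.2 fun a => ?_
    obtain ⟨ε, hε, ha⟩ := hA a a.2
    refine tendsto_nhds_of_eventually_eq ?_
    filter_upwards [Metric.ball_mem_nhds a hε] with b hb
    rw [ha b b.2 (by simpa [Subtype.dist_eq, dist_comm] using hb)]
  obtain ⟨δ, hδ, hfδ⟩ := Metric.uniformContinuous_iff.1 (hUC _ hf) 1 one_pos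
  obtain ⟨k, hk⟩ := exists_nat_one_div_lt hδ
  have hlt := hfδ (a := ⟨x k, hx k⟩) (b := ⟨y k, hy k⟩) ((hxy k).trans hk)
  simp only [Nat.dist_cast_real] at hlt
  have heq : g (x k) = g (y k) := by
    by_contra hgne
    exact absurd (Nat.pairwise_one_le_dist hgne) (not_le.2 hlt)
  exact hne k (hg (Or.inl ⟨k, rfl⟩) (Or.inr ⟨k, rfl⟩) heq)

theorem IsolationCondition.uniformlyDiscrete (h : IsolationCondition X) {A : Set X}
    (hA : DiscreteIn A) (hc : BourbakiQuasiCompleteIn A) : UniformlyDiscrete A :=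
  hA.uniformlyDiscrete fun _ hf => h.uniformContinuous_of_complete hc hf

theorem discreteIn_of_disjoint_accSet {U : Set X} (hU : Disjoint U (accSet X)) :
    DiscreteIn U := by
  intro x hx
  obtain ⟨ε, hε, h⟩ := Metric.eventually_nhds_iff.1
    (eventually_eq_of_notMem_accSet (Set.disjoint_left.1 hU hx))
  exact ⟨ε, hε, fun y _ hy => h (by rwa [dist_comm])⟩

theorem exists_degIsol_lt {U : Set X} (hne : U.Nonempty) (h : sInf (degIsol '' U) ≤ 0) (n : ℕ) :
    ∃ x ∈ U, degIsol x < 1 / ((n : ℝ) + 1) := by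
  obtain ⟨_, ⟨x, hx, rfl⟩, hlt⟩ := exists_lt_of_csInf_lt (hne.image degIsol)
    (h.trans_lt (Nat.one_div_pos_of_nat (n := n) (α := ℝ)))
  exact ⟨x, hx, hlt⟩

theorem IsolationCondition.sInf_pos (h : IsolationCondition X) {U : Set X} (hinf : U.Infinite)
    (hc : BourbakiQuasiCompleteIn U) (hU : Disjoint U (accSet X)) : 0 < sInf (degIsol '' U) := by
  by_contra! hcon
  choose u huU hu using exists_degIsol_lt hinf.nonempty hcon
  have hlim : Tendsto (fun n => degIsol (u n)) atTop (nhds 0) :=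
    squeeze_zero (fun n => degIsol_nonneg _) (fun n => (hu n).le)
      tendsto_one_div_add_atTop_nhds_zero_nat
  obtain ⟨c, hcU, φ, hφ, hφc⟩ := h.exists_tendsto hc huU hlim
  have hcA := Set.disjoint_left.1 hU hcU
  obtain ⟨y, -, hy⟩ := hinf.exists_notMem_finset {c}
  have hpos : 0 < degIsol c := degIsol_pos hcA (by simpa using hy)
  obtain ⟨n, hn, hn'⟩ := ((hφc.eventually (eventually_eq_of_notMem_accSet hcA)).and
    ((hlim.comp hφ.tendsto_atTop).eventually (gt_mem_nhds hpos))).exists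
  simp only [Function.comp_apply] at hn hn'
  rw [hn] at hn'
  exact lt_irrefl _ hn'

theorem hasBourbakiSubseq_of_subsingleton [Subsingleton X] (u : ℕ → X) : HasBourbakiSubseq u :=
  ⟨id, strictMono_id, fun ε _ => ⟨u 0, 0, fun n _ => by
    rw [Subsingleton.elim (u 0) ((u ∘ id) n)]; exact ChainConn.refl _ _⟩⟩

theorem IsolationCondition.sInf_range_pos (h : IsolationCondition X) {u : ℕ → X}
    (hu : ∀ n, u n ∉ accSet X) (hB : ¬ HasBourbakiSubseq u) :
    0 < sInf (Set.range fun n => degIsol (u n)) := by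
  by_contra! hcon
  have hX : Nontrivial X := by
    by_contra hX
    rw [not_nontrivial_iff_subsingleton] at hX
    exact hB (hasBourbakiSubseq_of_subsingleton u)
  have hpos : ∀ n, 0 < degIsol (u n) := fun n =>
    let ⟨_, hy⟩ := exists_ne (u n)
    degIsol_pos (hu n) hy
  have hlt : ∀ ε > (0 : ℝ), ∃ n, degIsol (u n) < ε := fun ε hε => by
    obtain ⟨_, ⟨n, rfl⟩, hn⟩ := exists_lt_of_csInf_lt (range_nonempty _) (hcon.trans_lt hε)
    exact ⟨n, hn⟩
  have hfreq : ∀ n : ℕ, ∃ᶠ k in atTop, degIsol (u k) < 1 / ((n : ℝ) + 1) := by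
    intro n hn
    obtain ⟨N, hN⟩ := eventually_atTop.1 hn
    obtain ⟨m, hm, hmin⟩ := Finset.exists_min_image (Finset.range (N + 1))
      (fun k => degIsol (u k)) ⟨0, by simp⟩
    obtain ⟨k, hk⟩ := hlt (min (1 / ((n : ℝ) + 1)) (degIsol (u m)))
      (lt_min Nat.one_div_pos_of_nat (hpos m))
    rcases lt_or_ge k N with hkN | hkN
    · exact absurd (hmin k (by simp; omega)) (not_le.2 (hk.trans_le (min_le_right _ _)))
    · exact hN k hkN (hk.trans_le (min_le_left _ _))
  obtain ⟨φ, hφ, hI⟩ := extraction_forall_of_frequently hfreq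
  obtain ⟨ψ, hψ, hB'⟩ := h (u ∘ φ) (squeeze_zero (fun n => degIsol_nonneg _)
    (fun n => (hI n).le) tendsto_one_div_add_atTop_nhds_zero_nat)
  exact hB ⟨φ ∘ ψ, hφ.comp hψ, hB'⟩

end Consequences

section Concatenation

variable {X : Type*} [MetricSpace X]

/-- The position (block, offset) after walking `m` steps through consecutive blocks of
lengths `len 0, len 1, …`. -/
def blockPosition (len : ℕ → ℕ) : ℕ → ℕ × ℕ
  | 0 => (0, 0)
  | m + 1 =>
    let s := blockPosition len m
    if s.2 + 1 < len s.1 then (s.1, s.2 + 1) else (s.1 + 1, 0)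

variable {len : ℕ → ℕ}

theorem blockPosition_snd_lt (hlen : ∀ k, 0 < len k) (m : ℕ) :
    (blockPosition len m).2 < len (blockPosition len m).1 := by
  induction m with
  | zero => exact hlen 0
  | succ m ih =>
    simp only [blockPosition]
    split_ifs with h
    · exact h
    · exact hlen _

theorem blockPosition_fst_mono : Monotone fun m => (blockPosition len m).1 := by
  refine monotone_nat_of_le_succ fun m => ?_
  simp only [blockPosition]
  split_ifs <;> simp

theorem blockPosition_fst_le (m : ℕ) : (blockPosition len m).1 ≤ m := by
  induction m with
  | zero => exact le_rfl
  | succ m ih =>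
    simp only [blockPosition]
    split_ifs <;> simp <;> omega

theorem exists_blockPosition_eq (hlen : ∀ k, 0 < len k) (k : ℕ) :
    ∃ m, blockPosition len m = (k, 0) := by
  induction k with
  | zero => exact ⟨0, rfl⟩
  | succ k ih =>
    have hoff : ∀ i < len k, ∃ m, blockPosition len m = (k, i) := by
      intro i
      induction i with
      | zero => exact fun _ => ih
      | succ i ihi =>
        intro hi
        obtain ⟨m, hm⟩ := ihi (by omega)
        exact ⟨m + 1, by simp [blockPosition, hm, hi]⟩
    obtain ⟨m, hm⟩ := hoff (len k - 1) (by have := hlen k; omega)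
    refine ⟨m + 1, ?_⟩
    have := hlen k
    simp only [blockPosition, hm]
    rw [if_neg (by omega)]

/-- Chains with vanishing step sizes, each starting at `x k` with first step to `y k` and
ending at `x (k + 1)`, concatenate to a quasi-Cauchy sequence. -/
theorem exists_quasiCauchy_through {x y : ℕ → X}
    (hxy : ∀ k : ℕ, dist (x k) (y k) < 1 / ((k : ℝ) + 1))
    (hchain : ∀ k : ℕ, ChainConn (1 / ((k : ℝ) + 1)) (y k) (x (k + 1))) :
    ∃ z : ℕ → X, QuasiCauchy z ∧ ∀ k, ∃ m ≥ k, z m = x k ∧ z (m + 1) = y k := by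
  choose n p hp0 hpn hp using hchain
  let q : ℕ → ℕ → X := fun k i => if i = 0 then x k else p k (i - 1)
  let len : ℕ → ℕ := fun k => n k + 1
  have hlen : ∀ k, 0 < len k := fun k => Nat.succ_pos _
  have hq : ∀ k, ∀ i < len k, dist (q k (i + 1)) (q k i) < 1 / ((k : ℝ) + 1) := by
    intro k i hi
    rw [dist_comm]
    rcases i with _ | i
    · simpa [q, hp0] using hxy k
    · simpa [q] using hp k i (by simpa [len] using hi)
  have hqlen : ∀ k, q k (len k) = q (k + 1) 0 := fun k => by simp [q, len, hpn]
  let z : ℕ → X := fun m => q (blockPosition len m).1 (blockPosition len m).2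
  have hz : ∀ m, z (m + 1) = q (blockPosition len m).1 ((blockPosition len m).2 + 1) := by
    intro m
    have := blockPosition_snd_lt hlen m
    simp only [z, blockPosition]
    split_ifs with h
    · rfl
    · rw [← hqlen]
      congr 1
      omega
  refine ⟨z, fun ε hε => ?_, fun k => ?_⟩
  · obtain ⟨K, hK⟩ := exists_nat_one_div_lt hε
    obtain ⟨M, hM⟩ := exists_blockPosition_eq hlen K
    refine ⟨M, fun m hm => ?_⟩
    rw [hz]
    refine (hq _ _ (blockPosition_snd_lt hlen m)).trans (lt_of_le_of_lt ?_ hK)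
    refine Nat.one_div_le_one_div ?_
    have := blockPosition_fst_mono (len := len) hm
    simpa only [hM] using this
  · obtain ⟨m, hm⟩ := exists_blockPosition_eq hlen k
    refine ⟨m, ?_, ?_, ?_⟩
    · simpa only [hm] using blockPosition_fst_le (len := len) m
    · simp [z, hm, q]
    · rw [hz, hm]
      simp [q, hp0]

theorem IsolationCondition.uniformContinuous_of_ward (h : IsolationCondition X) {f : X → ℝ}
    (hf : WardContinuous f) : UniformContinuous f := by
  rw [Metric.uniformContinuous_iff]
  by_contra! hcon
  obtain ⟨ε, hε, hcon⟩ := hcon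
  choose x y hxy hfxy using fun k : ℕ => hcon (1 / ((k : ℝ) + 1)) Nat.one_div_pos_of_nat
  have hne : ∀ n, x n ≠ y n := fun n heq => by
    have := hfxy n
    rw [heq, dist_self] at this
    linarith
  obtain ⟨φ, hφ, hB⟩ := h x (tendsto_degIsol_of_dist hne hxy)
  have hev : ∀ n : ℕ, ∀ᶠ k in atTop, ∀ m ≥ k,
      ChainConn (1 / ((n : ℝ) + 1)) (x (φ k)) (x (φ m)) := by
    intro n
    obtain ⟨p, N, hN⟩ := hB (1 / ((n : ℝ) + 1)) Nat.one_div_pos_of_nat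
    filter_upwards [eventually_ge_atTop N] with k hk m hm
    exact (hN k hk).symm.trans (hN m (hk.trans hm))
  obtain ⟨ψ, hψ, hchain⟩ := extraction_forall_of_eventually hev
  have hθ := hφ.comp hψ
  have hxy' : ∀ k : ℕ, dist (x (φ (ψ k))) (y (φ (ψ k))) < 1 / ((k : ℝ) + 1) := fun k =>
    (hxy _).trans_le (Nat.one_div_le_one_div (hθ.id_le k))
  obtain ⟨z, hz, hzm⟩ := exists_quasiCauchy_through (x := fun k => x (φ (ψ k)))
    (y := fun k => y (φ (ψ k))) hxy' (fun k =>
      (ChainConn.of_dist_lt (hxy' k)).symm.trans (hchain k _ (hψ (Nat.lt_succ_self k)).le))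
  obtain ⟨N, hN⟩ := hf z hz ε hε
  obtain ⟨m, hm, hx, hy⟩ := hzm N
  have := hN m hm
  simp only [Function.comp_apply, hx, hy] at this
  rw [dist_comm] at this
  exact absurd (hfxy _) (not_le.2 this)

end Concatenation

/-- Sequences of pairs of distinct, closer and closer points, the pairs lying in distinct
`ε`-chainable components. -/
structure SeparatedPairs {X : Type*} [MetricSpace X] (ε : ℝ) (x y : ℕ → X) : Prop where
  separated : ∀ i j, ChainConn ε (x i) (x j) → i = j
  ne : ∀ n, x n ≠ y n
  dist_lt : ∀ n, dist (x n) (y n) < ε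
  dist_lt_one_div : ∀ n : ℕ, dist (x n) (y n) < 1 / ((n : ℝ) + 1)

/-- The sequence `x 0, y 0, x 1, y 1, …`. -/
def interleave {X : Type*} (x y : ℕ → X) (n : ℕ) : X :=
  if n % 2 = 0 then x (n / 2) else y (n / 2)

theorem interleave_two_mul {X : Type*} (x y : ℕ → X) (n : ℕ) : interleave x y (2 * n) = x n := by
  simp [interleave]

theorem interleave_two_mul_add_one {X : Type*} (x y : ℕ → X) (n : ℕ) :
    interleave x y (2 * n + 1) = y n := by
  simp [interleave, Nat.add_mod, show (2 * n + 1) / 2 = n by omega]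

section SeparatedPairs

variable {X : Type*} [MetricSpace X]

theorem exists_separatedPairs_of_not_isolationCondition (h : ¬ IsolationCondition X) :
    ∃ ε x y, SeparatedPairs (X := X) ε x y := by
  unfold IsolationCondition at h
  push Not at h
  obtain ⟨u, hu, hB⟩ := h
  obtain ⟨ε, hε, φ, hφ, hsep⟩ := exists_separated_of_not_hasBourbakiSubseq hB
  have hX : Nontrivial X := by
    by_contra hX
    rw [not_nontrivial_iff_subsingleton] at hX
    exact hB (hasBourbakiSubseq_of_subsingleton u)
  have hev : ∀ n : ℕ, ∀ᶠ k in atTop, degIsol (u (φ k)) < min ε (1 / ((n : ℝ) + 1)) := fun n =>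
    (hu.comp hφ.tendsto_atTop).eventually (gt_mem_nhds (lt_min hε Nat.one_div_pos_of_nat))
  obtain ⟨ψ, hψ, hI⟩ := extraction_forall_of_eventually hev
  have hy : ∀ n : ℕ, ∃ y, y ≠ u (φ (ψ n)) ∧
      dist (u (φ (ψ n))) y < min ε (1 / ((n : ℝ) + 1)) := fun n => by
    obtain ⟨z, hz⟩ := exists_ne (u (φ (ψ n)))
    obtain ⟨y, hy, hd⟩ := (infDist_lt_iff (s := {u (φ (ψ n))}ᶜ) ⟨z, by simpa using hz⟩).1 (hI n)
    exact ⟨y, by simpa using hy, hd⟩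
  choose y hne hd using hy
  exact ⟨ε, fun n => u (φ (ψ n)), y, fun i j hij => hψ.injective (hsep _ _ hij),
    fun n => (hne n).symm, fun n => (hd n).trans_le (min_le_left _ _),
    fun n => (hd n).trans_le (min_le_right _ _)⟩

namespace SeparatedPairs

variable {ε : ℝ} {x y : ℕ → X}

theorem pos (h : SeparatedPairs ε x y) : 0 < ε := dist_nonneg.trans_lt (h.dist_lt 0)

theorem shift (h : SeparatedPairs ε x y) (N : ℕ) :
    SeparatedPairs ε (fun n => x (n + N)) (fun n => y (n + N)) where
  separated i j hij := Nat.add_right_cancel (h.separated _ _ hij)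
  ne n := h.ne _
  dist_lt n := h.dist_lt _
  dist_lt_one_div n := (h.dist_lt_one_div _).trans_le (Nat.one_div_le_one_div (by omega))

theorem separated_right (h : SeparatedPairs ε x y) (i j : ℕ) (hij : ChainConn ε (y i) (y j)) :
    i = j :=
  h.separated _ _ (((ChainConn.of_dist_lt (h.dist_lt i)).trans hij).trans
    (ChainConn.of_dist_lt (h.dist_lt j)).symm)

theorem chainConn_interleave (h : SeparatedPairs ε x y) (n : ℕ) :
    ChainConn ε (x (n / 2)) (interleave x y n) := by
  unfold interleave
  split_ifs
  · exact ChainConn.refl _ _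
  · exact ChainConn.of_dist_lt (h.dist_lt _)

theorem div_eq_of_chainConn (h : SeparatedPairs ε x y) {i j : ℕ}
    (hij : ChainConn ε (interleave x y i) (interleave x y j)) : i / 2 = j / 2 :=
  h.separated _ _ (((h.chainConn_interleave i).trans hij).trans (h.chainConn_interleave j).symm)

theorem injective_interleave (h : SeparatedPairs ε x y) :
    Function.Injective (interleave x y) := by
  intro i j hij
  have hdiv : i / 2 = j / 2 := h.div_eq_of_chainConn (hij ▸ ChainConn.refl _ _)
  have hne := h.ne (j / 2)
  unfold interleave at hij
  rw [hdiv] at hij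
  split_ifs at hij with h1 h2 h2
  · omega
  · exact absurd hij hne
  · exact absurd hij.symm hne
  · omega

theorem pseudoCauchy_interleave (h : SeparatedPairs ε x y) : PseudoCauchy (interleave x y) := by
  intro δ hδ n
  obtain ⟨k, hk⟩ := exists_nat_one_div_lt hδ
  refine ⟨2 * (n + k + 1), 2 * (n + k + 1) + 1, by omega, by omega, by omega, ?_⟩
  rw [interleave_two_mul, interleave_two_mul_add_one]
  exact ((h.dist_lt_one_div _).trans_le (Nat.one_div_le_one_div (by omega))).trans hk

theorem not_hasBourbakiSubseq_interleave (h : SeparatedPairs ε x y) :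
    ¬ HasBourbakiSubseq (interleave x y) := by
  rintro ⟨φ, hφ, hB⟩
  obtain ⟨p, N, hN⟩ := hB ε h.pos
  have := h.div_eq_of_chainConn ((hN N le_rfl).symm.trans (hN (N + 2) (by omega)))
  have h1 := hφ (show N < N + 1 by omega)
  have h2 := hφ (show N + 1 < N + 2 by omega)
  omega

theorem discreteIn_range (h : SeparatedPairs ε x y) : DiscreteIn (range (interleave x y)) := by
  rintro _ ⟨i, rfl⟩
  refine ⟨min ε (dist (x (i / 2)) (y (i / 2))), lt_min h.pos (dist_pos.2 (h.ne _)), ?_⟩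
  rintro _ ⟨j, rfl⟩ hij
  have hdiv := h.div_eq_of_chainConn (ChainConn.of_dist_lt (hij.trans_le (min_le_left _ _)))
  have hlt := hij.trans_le (min_le_right _ _)
  unfold interleave at hlt ⊢
  rw [← hdiv] at hlt ⊢
  split_ifs at hlt ⊢
  · rfl
  · exact absurd hlt (dist_comm _ _).not_lt
  · exact absurd hlt (lt_irrefl _)
  · rfl

theorem complete_range (h : SeparatedPairs ε x y) :
    BourbakiQuasiCompleteIn (range (interleave x y)) := by
  intro v hv hB
  choose k hk using hv
  obtain ⟨p, N, hN⟩ := hB ε h.pos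
  have hev : ∀ᶠ n in atTop, v n = x (k N / 2) ∨ v n = y (k N / 2) := by
    filter_upwards [eventually_ge_atTop N] with n hn
    have hc := (hN n hn).symm.trans (hN N le_rfl)
    rw [← hk n, ← hk N] at hc
    rw [← h.div_eq_of_chainConn hc, ← hk n]
    unfold interleave
    split_ifs <;> simp
  have hcl : ∀ c, (∃ᶠ n in atTop, v n = c) → MapClusterPt c atTop v := fun c hc =>
    mapClusterPt_iff_frequently.2 fun s hs => hc.mono fun n hn => hn ▸ mem_of_mem_nhds hs
  rcases frequently_or_distrib.1 hev.frequently with hx | hy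
  · exact ⟨_, ⟨2 * (k N / 2), interleave_two_mul _ _ _⟩, hcl _ hx⟩
  · exact ⟨_, ⟨2 * (k N / 2) + 1, interleave_two_mul_add_one _ _ _⟩, hcl _ hy⟩

theorem not_uniformlyDiscrete_range (h : SeparatedPairs ε x y) :
    ¬ UniformlyDiscrete (range (interleave x y)) := by
  rintro ⟨δ, hδ, hd⟩
  obtain ⟨k, hk⟩ := exists_nat_one_div_lt hδ
  have := hd (x k) ⟨2 * k, interleave_two_mul _ _ _⟩ (y k)
    ⟨2 * k + 1, interleave_two_mul_add_one _ _ _⟩ (h.ne k)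
  exact absurd ((h.dist_lt_one_div k).trans hk) (not_lt.2 this)

theorem infinite_range (h : SeparatedPairs ε x y) : (range (interleave x y)).Infinite :=
  infinite_range_of_injective h.injective_interleave

/-- If a set of degrees of isolation contains that of every `x n`, its infimum vanishes. -/
theorem sInf_le_zero (h : SeparatedPairs ε x y) {A : Set X} (hA : ∀ n, x n ∈ A) :
    sInf (degIsol '' A) ≤ 0 := by
  have hbdd : BddBelow (degIsol '' A) :=
    ⟨0, by rintro _ ⟨a, -, rfl⟩; exact degIsol_nonneg a⟩
  exact ge_of_tendsto (tendsto_degIsol_of_dist h.ne h.dist_lt_one_div)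
    (Eventually.of_forall fun n => csInf_le hbdd ⟨x n, hA n, rfl⟩)

/-- If the accumulation points are Bourbaki quasi-precompact, a tail of the pairs consists of
isolated points. -/
theorem exists_isolated (h : SeparatedPairs ε x y)
    (hP : BourbakiQuasiPrecompactIn (accSet X)) :
    ∃ x' y' : ℕ → X, SeparatedPairs ε x' y' ∧ (∀ n, x' n ∉ accSet X) ∧
      Disjoint (range (interleave x' y')) (accSet X) := by
  obtain ⟨N, hN⟩ := ((hP.finite_of_separated h.pos h.separated).union
    (hP.finite_of_separated h.pos h.separated_right)).bddAbove
  have hx : ∀ n, x (n + (N + 1)) ∉ accSet X := fun n hn => by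
    have := hN (Or.inl hn)
    omega
  have hy : ∀ n, y (n + (N + 1)) ∉ accSet X := fun n hn => by
    have := hN (Or.inr hn)
    omega
  refine ⟨_, _, h.shift (N + 1), hx, Set.disjoint_left.2 ?_⟩
  rintro _ ⟨n, rfl⟩
  unfold interleave
  split_ifs
  · exact hx _
  · exact hy _

/-- A ward continuous function which is not uniformly continuous: on the component of `x n` it is
a multiple of the distance to `x n`, normalized to be one at `y n`. -/
theorem exists_ward_not_uniformContinuous (h : SeparatedPairs ε x y) :
    ∃ f : X → ℝ, WardContinuous f ∧ ¬ UniformContinuous f := by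
  classical
  let f : X → ℝ := fun z =>
    if hz : ∃ n, ChainConn ε (x n) z then
      dist z (x hz.choose) / dist (y hz.choose) (x hz.choose) else 0
  have hfn : ∀ n z, ChainConn ε (x n) z → f z = dist z (x n) / dist (y n) (x n) := by
    intro n z hz
    have hex : ∃ n, ChainConn ε (x n) z := ⟨n, hz⟩
    have heq : hex.choose = n := h.separated _ _ (hex.choose_spec.trans hz.symm)
    simp only [f, dif_pos hex, heq]
  have hf0 : ∀ z, (¬ ∃ n, ChainConn ε (x n) z) → f z = 0 := fun z hz => dif_neg hz
  refine ⟨f, fun u hu δ hδ => ?_, fun hf => ?_⟩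
  · obtain ⟨N, hN⟩ := hu ε h.pos
    have hconn : ∀ n ≥ N, ChainConn ε (u N) (u n) := by
      intro n hn
      induction n, hn using Nat.le_induction with
      | base => exact ChainConn.refl _ _
      | succ n hn ih => exact ih.trans (ChainConn.of_dist_lt (hN n hn)).symm
    by_cases hex : ∃ n, ChainConn ε (x n) (u N)
    · obtain ⟨n, hn⟩ := hex
      have hr : 0 < dist (y n) (x n) := dist_pos.2 (h.ne n).symm
      obtain ⟨M, hM⟩ := hu (δ * dist (y n) (x n)) (mul_pos hδ hr)
      refine ⟨max N M, fun m hm => ?_⟩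
      have hmN : N ≤ m := (le_max_left _ _).trans hm
      simp only [Function.comp_apply]
      rw [hfn n _ (hn.trans (hconn _ hmN)), hfn n _ (hn.trans (hconn (m + 1) (by omega))),
        Real.dist_eq, ← sub_div, abs_div, abs_of_pos hr, div_lt_iff₀ hr]
      exact (abs_dist_sub_le _ _ _).trans_lt (hM m ((le_max_right _ _).trans hm))
    · refine ⟨N, fun m hm => ?_⟩
      have hz : ∀ m ≥ N, f (u m) = 0 := fun m hm =>
        hf0 _ fun ⟨n, hn⟩ => hex ⟨n, hn.trans (hconn m hm).symm⟩
      simp only [Function.comp_apply]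
      rwa [hz m hm, hz (m + 1) (by omega), dist_self]
  · obtain ⟨δ, hδ, hfδ⟩ := Metric.uniformContinuous_iff.1 hf 1 one_pos
    obtain ⟨k, hk⟩ := exists_nat_one_div_lt hδ
    have hlt := hfδ ((h.dist_lt_one_div k).trans hk)
    rw [hfn k _ (ChainConn.refl _ _), hfn k _ (ChainConn.of_dist_lt (h.dist_lt k)), dist_self,
      zero_div, div_self (dist_pos.2 (h.ne k).symm).ne'] at hlt
    norm_num at hlt

end SeparatedPairs

end SeparatedPairs

theorem stmt14 {X : Type*} [MetricSpace X] :
    List.TFAE [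
      ∀ f : X → ℝ, WardContinuous f → UniformContinuous f,
      ∀ u : ℕ → X, PseudoCauchy u → Function.Injective u →
        ∃ φ : ℕ → ℕ, StrictMono φ ∧ BourbakiQuasiCauchy (u ∘ φ),
      ∀ u : ℕ → X, Tendsto (fun n => degIsol (u n)) atTop (nhds 0) →
        ∃ φ : ℕ → ℕ, StrictMono φ ∧ BourbakiQuasiCauchy (u ∘ φ),
      BourbakiQuasiPrecompactIn (accSet X) ∧
        ∀ U : Set X, U.Infinite → BourbakiQuasiCompleteIn U →
          Disjoint U (accSet X) → UniformlyDiscrete U,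
      BourbakiQuasiPrecompactIn (accSet X) ∧
        ∀ U : Set X, U.Infinite → BourbakiQuasiCompleteIn U →
          Disjoint U (accSet X) → 0 < sInf (degIsol '' U),
      BourbakiQuasiPrecompactIn (accSet X) ∧
        ∀ u : ℕ → X, (∀ n, u n ∉ accSet X) →
          (¬ ∃ φ : ℕ → ℕ, StrictMono φ ∧ BourbakiQuasiCauchy (u ∘ φ)) →
          0 < sInf (Set.range fun n => degIsol (u n)),
      ∀ A : Set X, DiscreteIn A → BourbakiQuasiCompleteIn A → UniformlyDiscrete A,
      ∀ A : Set X, BourbakiQuasiCompleteIn A →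
        ∀ f : A → ℝ, Continuous f → UniformContinuous f] := by
  have to_pairs : ∀ {P : Prop}, (∀ ε x y, SeparatedPairs (X := X) ε x y → ¬ P) → P →
      IsolationCondition X := fun hP p => by
    by_contra h
    obtain ⟨ε, x, y, hxy⟩ := exists_separatedPairs_of_not_isolationCondition h
    exact hP ε x y hxy p
  tfae_have 3 → 1 := fun h _ hf => IsolationCondition.uniformContinuous_of_ward h hf
  tfae_have 1 → 3 := to_pairs fun ε x y hxy h => by
    obtain ⟨f, hf, hf'⟩ := hxy.exists_ward_not_uniformContinuous
    exact hf' (h f hf)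
  tfae_have 3 → 2 := fun h _ hu hinj =>
    IsolationCondition.hasBourbakiSubseq_of_pseudoCauchy h hu hinj
  tfae_have 2 → 3 := to_pairs fun ε x y hxy h =>
    hxy.not_hasBourbakiSubseq_interleave
      (h _ hxy.pseudoCauchy_interleave hxy.injective_interleave)
  tfae_have 3 → 4 := fun h => ⟨IsolationCondition.precompact_accSet h, fun _ _ hc hU =>
    IsolationCondition.uniformlyDiscrete h (discreteIn_of_disjoint_accSet hU) hc⟩
  tfae_have 4 → 3 := to_pairs fun ε x y hxy h => by
    obtain ⟨x', y', hxy', -, hdisj⟩ := hxy.exists_isolated h.1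
    exact hxy'.not_uniformlyDiscrete_range
      (h.2 _ hxy'.infinite_range hxy'.complete_range hdisj)
  tfae_have 3 → 5 := fun h => ⟨IsolationCondition.precompact_accSet h, fun _ hinf hc hU =>
    IsolationCondition.sInf_pos h hinf hc hU⟩
  tfae_have 5 → 3 := to_pairs fun ε x y hxy h => by
    obtain ⟨x', y', hxy', -, hdisj⟩ := hxy.exists_isolated h.1
    exact absurd (h.2 _ hxy'.infinite_range hxy'.complete_range hdisj)
      (not_lt.2 (hxy'.sInf_le_zero fun n => ⟨2 * n, interleave_two_mul _ _ _⟩))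
  tfae_have 3 → 6 := fun h => ⟨IsolationCondition.precompact_accSet h, fun _ hu hB =>
    IsolationCondition.sInf_range_pos h hu hB⟩
  tfae_have 6 → 3 := to_pairs fun ε x y hxy h => by
    obtain ⟨x', y', hxy', hiso, -⟩ := hxy.exists_isolated h.1
    have hpos := h.2 x' hiso (not_hasBourbakiSubseq_of_separated hxy'.pos hxy'.separated)
    have hle := hxy'.sInf_le_zero (A := range x') fun n => ⟨n, rfl⟩
    rw [← range_comp] at hle
    exact absurd hpos (not_lt.2 hle)
  tfae_have 3 → 8 := fun h _ hA _ hf => IsolationCondition.uniformContinuous_of_complete h hA hf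
  tfae_have 8 → 7 := fun h A hA hc => hA.uniformlyDiscrete (h A hc)
  tfae_have 7 → 3 := to_pairs fun ε x y hxy h =>
    hxy.not_uniformlyDiscrete_range (h _ hxy.discreteIn_range hxy.complete_range)
  tfae_finish
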